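/- There exist positive constants C, C' and c such that for every integer k ≥ 1 and every s ∈ [0, c/√k], one has C s² ≤ Ω_k(s)/√k ≤ C' s². -/

import Mathlib

noncomputable section

open MeasureTheory ProbabilityTheory Real Filter Finset

/-- Physicists' Hermite polynomials: `H 0 = 1`, `H 1 x = 2 * x`,
`H (n+2) x = 2 * x * H (n+1) x - 2 * (n+1) * H n x`. -/
def physHermite : ℕ → ℝ → ℝ
  | 0, _ => 1
  | 1, x => 2 * x
  | (n + 2), x => 2 * x * physHermite (n + 1) x - 2 * (n + 1) * physHermite n x

/-- The `L²(ℝ)`-normalized Hermite functions. -/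
def hermiteFun (n : ℕ) (x : ℝ) : ℝ :=
  physHermite n x * Real.exp (-x ^ 2 / 2) /
    Real.sqrt (n.factorial * 2 ^ n * Real.sqrt Real.pi)

/-- `Ω_k(s) = h_k(1)² - h_k(√(1-s)) h_k(√(1+s))`. -/
def OmegaFun (k : ℕ) (s : ℝ) : ℝ :=
  hermiteFun k 1 ^ 2 - hermiteFun k (Real.sqrt (1 - s)) * hermiteFun k (Real.sqrt (1 + s))


/-- A function vanishing at `0` with nonnegative derivative on `[0, r]` is nonnegative there. -/
lemma nonneg_of_hasDerivAt_nonneg {f f' : ℝ → ℝ} {r : ℝ} (h0 : f 0 = 0)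
    (hf : ∀ x ∈ Set.Icc 0 r, HasDerivAt f (f' x) x) (hf' : ∀ x ∈ Set.Icc 0 r, 0 ≤ f' x) :
    ∀ x ∈ Set.Icc 0 r, 0 ≤ f x := by
  intro x hx
  have hmono : MonotoneOn f (Set.Icc 0 r) := by
    refine monotoneOn_of_deriv_nonneg (convex_Icc 0 r)
      (fun y hy => (hf y hy).continuousAt.continuousWithinAt) ?_ ?_
    · intro y hy
      exact (hf y (interior_subset hy)).differentiableAt.differentiableWithinAt
    · intro y hy
      rw [(hf y (interior_subset hy)).deriv]
      exact hf' y (interior_subset hy)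
  have := hmono ⟨le_rfl, hx.1.trans hx.2⟩ hx hx.1
  rwa [h0] at this

lemma abs_mul_le_half_sq_add_half_sq (x y : ℝ) : |x * y| ≤ x ^ 2 / 2 + y ^ 2 / 2 := by
  rw [abs_le]
  constructor <;> linarith [sq_nonneg (x + y), sq_nonneg (x - y)]

/-- The Wronskian-type derivative of `s ↦ g(1)² - g(1-s) g(1+s)` has derivative comparable
to the energy `S²`, given pointwise bounds on the values of the solution at `1 ± s`. -/
lemma wronskian_deriv_bounds {r S s a b p q : ℝ} (hr : 1 ≤ r) (hs0 : 0 ≤ s)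
    (hs : s ≤ 1 / 100)
    (ha : (r * a) ^ 2 ≤ S ^ 2) (hb : (r * b) ^ 2 ≤ S ^ 2) (hp : p ^ 2 ≤ S ^ 2)
    (hq : q ^ 2 ≤ S ^ 2) (hab : (r * (a - b)) ^ 2 ≤ S ^ 2 / 2500)
    (hpq : (p - q) ^ 2 ≤ 9 * S ^ 2 / 2500)
    (hEa : S ^ 2 / 8 ≤ 4 * (1 - s) * p ^ 2 + (2 * r ^ 2 + 1 - (1 - s)) * a ^ 2)
    (hEb : S ^ 2 / 8 ≤ 4 * (1 + s) * q ^ 2 + (2 * r ^ 2 + 1 - (1 + s)) * b ^ 2) :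
    S ^ 2 / 50 ≤ 2 * p * q + (2 * p + (2 * r ^ 2 + 1 - (1 - s)) * a) / (4 * (1 - s)) * b
        + a * ((2 * q + (2 * r ^ 2 + 1 - (1 + s)) * b) / (4 * (1 + s))) ∧
      2 * p * q + (2 * p + (2 * r ^ 2 + 1 - (1 - s)) * a) / (4 * (1 - s)) * b
        + a * ((2 * q + (2 * r ^ 2 + 1 - (1 + s)) * b) / (4 * (1 + s))) ≤ 6 * S ^ 2 := by
  obtain ⟨μ, hμ⟩ : ∃ μ, μ = 1 / (1 - s) := ⟨_, rfl⟩
  obtain ⟨ν, hν⟩ : ∃ ν, ν = 1 / (1 + s) := ⟨_, rfl⟩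
  have hμ1 : 1 ≤ μ := by rw [hμ, le_div_iff₀] <;> linarith
  have hμ2 : μ ≤ 100 / 99 := by rw [hμ, div_le_div_iff₀] <;> linarith
  have hν1 : 100 / 101 ≤ ν := by rw [hν, div_le_div_iff₀] <;> linarith
  have hν2 : ν ≤ 1 := by rw [hν, div_le_iff₀] <;> linarith
  have hr2 : 1 ≤ r ^ 2 := by nlinarith
  obtain ⟨K, hK⟩ : ∃ K, K = (2 * r ^ 2 + s) * μ / 4 + (2 * r ^ 2 - s) * ν / 4 := ⟨_, rfl⟩
  have hexp : 2 * p * q + (2 * p + (2 * r ^ 2 + 1 - (1 - s)) * a) / (4 * (1 - s)) * b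
        + a * ((2 * q + (2 * r ^ 2 + 1 - (1 + s)) * b) / (4 * (1 + s)))
      = 2 * p * q + μ / 2 * (p * b) + ν / 2 * (a * q) + K * (a * b) := by
    have h1 : 1 - s ≠ 0 := by linarith
    have h2 : 1 + s ≠ 0 := by linarith
    rw [hK, hμ, hν]
    field_simp
    ring
  rw [hexp]
  have hμK1 : 2 * r ^ 2 ≤ (2 * r ^ 2 + s) * μ := by nlinarith
  have hμK2 : (2 * r ^ 2 + s) * μ ≤ (2 * r ^ 2 + 1 / 100) * (100 / 99) :=
    mul_le_mul (by linarith) hμ2 (by linarith) (by linarith)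
  have hνK1 : (2 * r ^ 2 - 1 / 100) * (100 / 101) ≤ (2 * r ^ 2 - s) * ν :=
    mul_le_mul (by linarith) hν1 (by norm_num) (by linarith)
  have hνK2 : (2 * r ^ 2 - s) * ν ≤ 2 * r ^ 2 := by nlinarith
  have hK1 : 0.93 * r ^ 2 ≤ K := by rw [hK]; linarith
  have hK2 : K ≤ 1.1 * r ^ 2 := by rw [hK]; linarith
  have hpb := abs_mul_le_half_sq_add_half_sq p b
  have haq := abs_mul_le_half_sq_add_half_sq a q
  have hμpb : |μ / 2 * (p * b)| ≤ 0.51 * (p ^ 2 / 2 + b ^ 2 / 2) := by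
    rw [abs_mul, abs_of_nonneg (by linarith)]
    exact mul_le_mul (by linarith) hpb (abs_nonneg _) (by norm_num)
  have hνaq : |ν / 2 * (a * q)| ≤ 0.51 * (a ^ 2 / 2 + q ^ 2 / 2) := by
    rw [abs_mul, abs_of_nonneg (by linarith)]
    exact mul_le_mul (by linarith) haq (abs_nonneg _) (by norm_num)
  have hA : a ^ 2 ≤ r ^ 2 * a ^ 2 := le_mul_of_one_le_left (sq_nonneg a) hr2
  have hB : b ^ 2 ≤ r ^ 2 * b ^ 2 := le_mul_of_one_le_left (sq_nonneg b) hr2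
  have hKab : K * (a * b) = K * a ^ 2 / 2 + K * b ^ 2 / 2 - K * (a - b) ^ 2 / 2 := by ring
  have hKa1 := mul_le_mul_of_nonneg_right hK1 (sq_nonneg a)
  have hKa2 := mul_le_mul_of_nonneg_right hK2 (sq_nonneg a)
  have hKb1 := mul_le_mul_of_nonneg_right hK1 (sq_nonneg b)
  have hKb2 := mul_le_mul_of_nonneg_right hK2 (sq_nonneg b)
  have hKd1 := mul_le_mul_of_nonneg_right hK1 (sq_nonneg (a - b))
  have hKd2 := mul_le_mul_of_nonneg_right hK2 (sq_nonneg (a - b))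
  have h2pq : 2 * p * q = p ^ 2 + q ^ 2 - (p - q) ^ 2 := by ring
  rw [mul_pow] at ha hb hab
  have hd0 : 0 ≤ r ^ 2 * (a - b) ^ 2 := by positivity
  obtain ⟨hl1, hu1⟩ := abs_le.mp hμpb
  obtain ⟨hl2, hu2⟩ := abs_le.mp hνaq
  constructor
  · have hsp : 0 ≤ s * p ^ 2 := by positivity
    have hsa : s * a ^ 2 ≤ 1 / 100 * a ^ 2 := mul_le_mul_of_nonneg_right hs (sq_nonneg a)
    have hsq : s * q ^ 2 ≤ 1 / 100 * q ^ 2 := mul_le_mul_of_nonneg_right hs (sq_nonneg q)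
    have hsb : 0 ≤ s * b ^ 2 := by positivity
    have := sq_nonneg p
    have := sq_nonneg q
    have := sq_nonneg a
    have := sq_nonneg b
    have := sq_nonneg S
    linarith
  · have := sq_nonneg (p - q)
    have := sq_nonneg S
    linarith

/-- Quantitative concavity of `s ↦ g(1-s) g(1+s)` for an oscillatory solution `g` of
`4 u g'' + 2 g' + (2 r² + 1 - u) g = 0` with energy comparable to `S²`. -/
lemma sq_sub_mul_bounds {g p : ℝ → ℝ} {r S : ℝ} (hr : 1 ≤ r) (hS : 0 ≤ S)
    (hg : ∀ u, 0 < u → HasDerivAt g (p u) u)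
    (hp : ∀ u, 0 < u → HasDerivAt p (-((2 * p u + (2 * r ^ 2 + 1 - u) * g u) / (4 * u))) u)
    (hE1 : ∀ u, 0 < u → u ≤ 2 → S ^ 2 / 8 ≤ 4 * u * p u ^ 2 + (2 * r ^ 2 + 1 - u) * g u ^ 2)
    (hE2 : ∀ u, 0 < u → u ≤ 2 → 4 * u * p u ^ 2 + (2 * r ^ 2 + 1 - u) * g u ^ 2 ≤ S ^ 2) :
    ∀ s ∈ Set.Icc 0 (1 / 100 / r),
      S ^ 2 / 100 * s ^ 2 ≤ g 1 ^ 2 - g (1 - s) * g (1 + s) ∧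
      g 1 ^ 2 - g (1 - s) * g (1 + s) ≤ 3 * S ^ 2 * s ^ 2 := by
  have hr2 : 1 ≤ r ^ 2 := by nlinarith
  have hr0 : 0 < r := by linarith
  have hpS : ∀ u ∈ Set.Icc (1 / 2 : ℝ) (3 / 2), |p u| ≤ S := by
    intro u ⟨hu1, hu2⟩
    refine abs_le_of_sq_le_sq ?_ hS
    have h1 : 1 * p u ^ 2 ≤ 4 * u * p u ^ 2 :=
      mul_le_mul_of_nonneg_right (by linarith) (sq_nonneg _)
    have h2 : 0 ≤ (2 * r ^ 2 + 1 - u) * g u ^ 2 := mul_nonneg (by linarith) (sq_nonneg _)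
    linarith [hE2 u (by linarith) (by linarith)]
  have hgS : ∀ u ∈ Set.Icc (1 / 2 : ℝ) (3 / 2), |r * g u| ≤ S := by
    intro u ⟨hu1, hu2⟩
    refine abs_le_of_sq_le_sq ?_ hS
    have h1 : 0 ≤ 4 * u * p u ^ 2 := mul_nonneg (by linarith) (sq_nonneg _)
    have h2 : r ^ 2 * g u ^ 2 ≤ (2 * r ^ 2 + 1 - u) * g u ^ 2 :=
      mul_le_mul_of_nonneg_right (by linarith) (sq_nonneg _)
    rw [mul_pow]
    linarith [hE2 u (by linarith) (by linarith)]
  have hp'S : ∀ u ∈ Set.Icc (1 / 2 : ℝ) (3 / 2),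
      |-((2 * p u + (2 * r ^ 2 + 1 - u) * g u) / (4 * u))| ≤ 3 * (r * S) := by
    intro u hu
    obtain ⟨hu1, hu2⟩ := hu
    rw [abs_neg, abs_div, abs_of_pos (by linarith : 0 < 4 * u), div_le_iff₀ (by linarith)]
    have h1 : |(2 * r ^ 2 + 1 - u) * g u| ≤ 3 * (r * S) := by
      have h2 := hgS u ⟨hu1, hu2⟩
      rw [abs_mul, abs_of_pos hr0] at h2
      rw [abs_mul, abs_of_pos (by linarith)]
      calc (2 * r ^ 2 + 1 - u) * |g u| ≤ (3 * r ^ 2) * |g u| :=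
            mul_le_mul_of_nonneg_right (by linarith) (abs_nonneg _)
        _ = 3 * (r * (r * |g u|)) := by ring
        _ ≤ 3 * (r * S) := by gcongr
    have h3 := hpS u ⟨hu1, hu2⟩
    have h4 : S ≤ r * S := le_mul_of_one_le_left hS hr
    have h5 : 1 / 2 * (r * S) ≤ u * (r * S) := mul_le_mul_of_nonneg_right hu1 (by positivity)
    calc _ ≤ |2 * p u| + |(2 * r ^ 2 + 1 - u) * g u| := abs_add_le _ _
      _ ≤ 2 * S + 3 * (r * S) := by rw [abs_mul, abs_two]; linarith
      _ ≤ _ := by linarith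
  have hscale : ∀ s ∈ Set.Icc 0 (1 / 100 / r), s ≤ 1 / 100 ∧ r * s ≤ 1 / 100 := by
    intro s ⟨hs0, hs⟩
    rw [le_div_iff₀ hr0] at hs
    constructor <;> nlinarith
  set V : ℝ → ℝ := fun s => 2 * p (1 - s) * p (1 + s)
      + (2 * p (1 - s) + (2 * r ^ 2 + 1 - (1 - s)) * g (1 - s)) / (4 * (1 - s)) * g (1 + s)
      + g (1 - s) * ((2 * p (1 + s) + (2 * r ^ 2 + 1 - (1 + s)) * g (1 + s)) / (4 * (1 + s)))
    with hV
  have hVb : ∀ s ∈ Set.Icc 0 (1 / 100 / r), S ^ 2 / 50 ≤ V s ∧ V s ≤ 6 * S ^ 2 := by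
    intro s hs
    obtain ⟨hs1, hs2⟩ := hscale s hs
    have hs0 := hs.1
    have hm : 1 - s ∈ Set.Icc (1 / 2 : ℝ) (3 / 2) := ⟨by linarith, by linarith⟩
    have hM : 1 + s ∈ Set.Icc (1 / 2 : ℝ) (3 / 2) := ⟨by linarith, by linarith⟩
    have hnorm : |1 - s - (1 + s)| = 2 * s := by
      rw [show 1 - s - (1 + s) = -(2 * s) by ring, abs_neg, abs_of_nonneg (by linarith)]
    have hdg : |g (1 - s) - g (1 + s)| ≤ S * (2 * s) := by
      have := (convex_Icc (1 / 2 : ℝ) (3 / 2)).norm_image_sub_le_of_norm_hasDerivWithin_le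
        (f := g) (f' := p) (fun u hu => (hg u (by linarith [hu.1])).hasDerivWithinAt) hpS hM hm
      rwa [Real.norm_eq_abs, Real.norm_eq_abs, hnorm] at this
    have hdp : |p (1 - s) - p (1 + s)| ≤ 3 * (r * S) * (2 * s) := by
      have := (convex_Icc (1 / 2 : ℝ) (3 / 2)).norm_image_sub_le_of_norm_hasDerivWithin_le
        (f := p) (fun u hu => (hp u (by linarith [hu.1])).hasDerivWithinAt) hp'S hM hm
      rwa [Real.norm_eq_abs, Real.norm_eq_abs, hnorm] at this
    have hrs : S * (r * s) ≤ S * (1 / 100) := mul_le_mul_of_nonneg_left hs2 hS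
    refine wronskian_deriv_bounds hr hs0 hs1 (sq_le_sq' ?_ ?_) (sq_le_sq' ?_ ?_)
      (sq_le_sq' ?_ ?_) (sq_le_sq' ?_ ?_) ?_ ?_
      (hE1 _ (by linarith) (by linarith)) (hE1 _ (by linarith) (by linarith))
    · exact (abs_le.mp (hgS _ hm)).1
    · exact (abs_le.mp (hgS _ hm)).2
    · exact (abs_le.mp (hgS _ hM)).1
    · exact (abs_le.mp (hgS _ hM)).2
    · exact (abs_le.mp (hpS _ hm)).1
    · exact (abs_le.mp (hpS _ hm)).2
    · exact (abs_le.mp (hpS _ hM)).1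
    · exact (abs_le.mp (hpS _ hM)).2
    · have h1 : |r * (g (1 - s) - g (1 + s))| ≤ S / 50 := by
        rw [abs_mul, abs_of_pos hr0]
        calc _ ≤ r * (S * (2 * s)) := by gcongr
          _ ≤ _ := by linarith
      calc _ ≤ (S / 50) ^ 2 := sq_le_sq' (abs_le.mp h1).1 (abs_le.mp h1).2
        _ = _ := by ring
    · have h1 : |p (1 - s) - p (1 + s)| ≤ 3 * S / 50 := by linarith
      calc _ ≤ (3 * S / 50) ^ 2 := sq_le_sq' (abs_le.mp h1).1 (abs_le.mp h1).2
        _ = _ := by ring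
  have hsub : ∀ {f : ℝ → ℝ} {f' s : ℝ}, HasDerivAt f f' (1 - s) →
      HasDerivAt (fun s => f (1 - s)) (-f') s := fun {f f' s} hf => by
    simpa using hf.comp_const_sub 1 s
  have hadd : ∀ {f : ℝ → ℝ} {f' s : ℝ}, HasDerivAt f f' (1 + s) →
      HasDerivAt (fun s => f (1 + s)) f' s := fun {f f' s} hf => hf.comp_const_add 1 s
  set W : ℝ → ℝ := fun s => p (1 - s) * g (1 + s) - g (1 - s) * p (1 + s) with hW
  have hOd : ∀ s ∈ Set.Icc 0 (1 / 100 / r),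
      HasDerivAt (fun s => g 1 ^ 2 - g (1 - s) * g (1 + s)) (W s) s := by
    intro s hs
    obtain ⟨hs1, -⟩ := hscale s hs
    have hs0 := hs.1
    refine HasDerivAt.congr_deriv (((hsub (hg (1 - s) (by linarith))).mul
      (hadd (hg (1 + s) (by linarith)))).const_sub (g 1 ^ 2)) ?_
    simp only [hW]
    ring
  have hWd : ∀ s ∈ Set.Icc 0 (1 / 100 / r), HasDerivAt W (V s) s := by
    intro s hs
    obtain ⟨hs1, -⟩ := hscale s hs
    have hs0 := hs.1
    refine HasDerivAt.congr_deriv (((hsub (hp (1 - s) (by linarith))).mul (hadd (hg (1 + s) (by linarith)))).sub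
      ((hsub (hg (1 - s) (by linarith))).mul (hadd (hp (1 + s) (by linarith))))) ?_
    simp only [hV]
    ring
  have hlin : ∀ c s : ℝ, HasDerivAt (fun s => c * s) c s := fun c s => by
    simpa using (hasDerivAt_id s).const_mul c
  have hquad : ∀ c s : ℝ, HasDerivAt (fun s => c * s ^ 2) (2 * c * s) s := fun c s => by
    refine HasDerivAt.congr_deriv ((hasDerivAt_pow 2 s).const_mul c) ?_
    ring
  have hW1 : ∀ s ∈ Set.Icc 0 (1 / 100 / r), 0 ≤ W s - S ^ 2 / 50 * s :=
    nonneg_of_hasDerivAt_nonneg (by simp [hW]; ring)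
      (fun s hs => (hWd s hs).sub (hlin _ s)) (fun s hs => by linarith [(hVb s hs).1])
  have hW2 : ∀ s ∈ Set.Icc 0 (1 / 100 / r), 0 ≤ 6 * S ^ 2 * s - W s :=
    nonneg_of_hasDerivAt_nonneg (by simp [hW]; ring)
      (fun s hs => (hlin _ s).sub (hWd s hs)) (fun s hs => by linarith [(hVb s hs).2])
  have hO1 : ∀ s ∈ Set.Icc 0 (1 / 100 / r),
      0 ≤ g 1 ^ 2 - g (1 - s) * g (1 + s) - S ^ 2 / 100 * s ^ 2 :=
    nonneg_of_hasDerivAt_nonneg (by simp; ring)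
      (fun s hs => (hOd s hs).sub (hquad _ s)) (fun s hs => by linarith [hW1 s hs])
  have hO2 : ∀ s ∈ Set.Icc 0 (1 / 100 / r),
      0 ≤ 3 * S ^ 2 * s ^ 2 - (g 1 ^ 2 - g (1 - s) * g (1 + s)) :=
    nonneg_of_hasDerivAt_nonneg (by simp; ring)
      (fun s hs => (hquad _ s).sub (hOd s hs)) (fun s hs => by linarith [hW2 s hs])
  exact fun s hs => ⟨by linarith [hO1 s hs], by linarith [hO2 s hs]⟩

/-- Energy bounds for the Hermite equation `h'' = (x² - N) h` on `[0, √2]`. -/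
lemma hermite_energy_bounds {h d : ℝ → ℝ} {N : ℝ} (hN : 3 ≤ N)
    (hh : ∀ x, HasDerivAt h (d x) x) (hd : ∀ x, HasDerivAt d ((x ^ 2 - N) * h x) x)
    {x : ℝ} (hx0 : 0 ≤ x) (hx : x ^ 2 ≤ 2) :
    (d 0 ^ 2 + N * h 0 ^ 2) / 8 ≤ d x ^ 2 + (N - x ^ 2) * h x ^ 2 ∧
      d x ^ 2 + (N - x ^ 2) * h x ^ 2 ≤ d 0 ^ 2 + N * h 0 ^ 2 := by
  have hsq : ∀ y ∈ Set.Icc 0 x, y ^ 2 ≤ 2 := fun y hy =>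
    (pow_le_pow_left₀ hy.1 hy.2 2).trans hx
  have hE : ∀ y, HasDerivAt (fun y => d y ^ 2 + (N - y ^ 2) * h y ^ 2) (-(2 * y * h y ^ 2)) y := by
    intro y
    refine HasDerivAt.congr_deriv (((hd y).pow 2).add
      (((hasDerivAt_pow 2 y).const_sub N).mul ((hh y).pow 2))) ?_
    simp
    ring
  have hexp : ∀ y : ℝ, HasDerivAt (fun y => Real.exp (y ^ 2)) (Real.exp (y ^ 2) * (2 * y)) y := by
    intro y
    simpa using (hasDerivAt_pow 2 y).exp
  have hup : 0 ≤ (d 0 ^ 2 + N * h 0 ^ 2) - (d x ^ 2 + (N - x ^ 2) * h x ^ 2) :=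
    nonneg_of_hasDerivAt_nonneg (by simp) (fun y _ => (hE y).const_sub (d 0 ^ 2 + N * h 0 ^ 2))
      (fun y hy => by have := hy.1; rw [neg_neg]; positivity) x ⟨hx0, le_rfl⟩
  have hlow : 0 ≤ (d x ^ 2 + (N - x ^ 2) * h x ^ 2) * Real.exp (x ^ 2)
      - (d 0 ^ 2 + N * h 0 ^ 2) := by
    refine nonneg_of_hasDerivAt_nonneg (by simp)
      (fun y _ => ((hE y).mul (hexp y)).sub_const (d 0 ^ 2 + N * h 0 ^ 2))
      (fun y hy => ?_) x ⟨hx0, le_rfl⟩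
    have h1 : 0 ≤ N - 1 - y ^ 2 := by linarith [hsq y hy]
    have h2 := hy.1
    have h3 : 0 ≤ 2 * y * Real.exp (y ^ 2) * (d y ^ 2 + (N - 1 - y ^ 2) * h y ^ 2) := by
      positivity
    linarith
  have he : Real.exp (x ^ 2) ≤ 8 := by
    have h1 : Real.exp (x ^ 2) ≤ Real.exp 1 ^ 2 := by
      rw [← Real.exp_nat_mul]
      exact Real.exp_le_exp.mpr (by simpa using hx)
    have h2 := Real.exp_one_lt_d9
    have h3 := Real.exp_pos 1
    nlinarith
  have hpos : 0 ≤ d x ^ 2 + (N - x ^ 2) * h x ^ 2 := by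
    have : 0 ≤ N - x ^ 2 := by linarith
    positivity
  have := mul_le_mul_of_nonneg_left he hpos
  exact ⟨by linarith, by linarith⟩

lemma hasDerivAt_physHermite_succ (n : ℕ) (x : ℝ) :
    HasDerivAt (physHermite (n + 1)) (2 * (n + 1) * physHermite n x) x := by
  induction n using Nat.twoStepInduction with
  | zero =>
    have : HasDerivAt (fun x : ℝ => 2 * x) 2 x := by simpa using (hasDerivAt_id x).const_mul 2
    simpa [physHermite] using this
  | one =>
    have h2 : physHermite 2 = fun y => 4 * y ^ 2 - 2 := by
      funext y; simp [physHermite]; ring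
    rw [h2]
    refine HasDerivAt.congr_deriv (((hasDerivAt_pow 2 x).const_mul 4).sub_const 2) ?_
    simp only [physHermite]
    push_cast
    ring
  | more n ih0 ih1 =>
    have hlin : HasDerivAt (fun x : ℝ => 2 * x) 2 x := by
      simpa using (hasDerivAt_id x).const_mul 2
    have h3 : physHermite (n + 2 + 1) = fun y =>
        2 * y * physHermite (n + 1 + 1) y - 2 * ((n + 1 : ℕ) + 1) * physHermite (n + 1) y := by
      funext y; rw [physHermite]
    rw [h3]
    refine HasDerivAt.congr_deriv ((hlin.mul ih1).sub (ih0.const_mul (2 * (((n + 1 : ℕ) : ℝ) + 1)))) ?_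
    simp only [physHermite]
    push_cast
    ring

/-- The constant normalizing the `n`-th Hermite function. -/
def hermiteNorm (n : ℕ) : ℝ := Real.sqrt (n.factorial * 2 ^ n * Real.sqrt Real.pi)

/-- The derivative of the Hermite function of index `n + 1`. -/
def hermiteFunDeriv (n : ℕ) (x : ℝ) : ℝ :=
  (2 * (n + 1) * physHermite n x - x * physHermite (n + 1) x) * Real.exp (-x ^ 2 / 2)
    / hermiteNorm (n + 1)

lemma hasDerivAt_exp_neg_sq_div_two (x : ℝ) :
    HasDerivAt (fun x : ℝ => Real.exp (-x ^ 2 / 2)) (-(x * Real.exp (-x ^ 2 / 2))) x := by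
  refine HasDerivAt.congr_deriv ((((hasDerivAt_pow 2 x).neg).div_const 2).exp) ?_
  simp
  ring

lemma hasDerivAt_hermiteFun (n : ℕ) (x : ℝ) :
    HasDerivAt (hermiteFun (n + 1)) (hermiteFunDeriv n x) x := by
  refine HasDerivAt.congr_deriv (((hasDerivAt_physHermite_succ n x).mul
    (hasDerivAt_exp_neg_sq_div_two x)).div_const (hermiteNorm (n + 1))) ?_
  rw [hermiteFunDeriv]
  ring

lemma hasDerivAt_hermiteFunDeriv (n : ℕ) (x : ℝ) :
    HasDerivAt (hermiteFunDeriv n)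
      ((x ^ 2 - (2 * ((n + 1 : ℕ) : ℝ) + 1)) * hermiteFun (n + 1) x) x := by
  have hfun : hermiteFunDeriv n = fun y =>
      (2 * (n + 1) * physHermite n y - y * physHermite (n + 1) y) * Real.exp (-y ^ 2 / 2)
        / hermiteNorm (n + 1) := rfl
  rw [hfun]
  have hmul := (hasDerivAt_id x).mul (hasDerivAt_physHermite_succ n x)
  have hval : hermiteFun (n + 1) x
      = physHermite (n + 1) x * Real.exp (-x ^ 2 / 2) / hermiteNorm (n + 1) := rfl
  rw [hval]
  cases n with
  | zero =>
    have h0 : HasDerivAt (physHermite 0) 0 x := by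
      have : physHermite 0 = fun _ => 1 := by funext y; rw [physHermite]
      rw [this]; exact hasDerivAt_const x 1
    refine HasDerivAt.congr_deriv ((((h0.const_mul (2 * (((0 : ℕ) : ℝ) + 1))).sub hmul).mul
      (hasDerivAt_exp_neg_sq_div_two x)).div_const (hermiteNorm (0 + 1))) ?_
    simp [physHermite]
    ring
  | succ m =>
    refine HasDerivAt.congr_deriv (((((hasDerivAt_physHermite_succ m x).const_mul (2 * (((m + 1 : ℕ) : ℝ) + 1))).sub
      hmul).mul (hasDerivAt_exp_neg_sq_div_two x)).div_const (hermiteNorm (m + 1 + 1))) ?_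
    simp [physHermite]
    ring

lemma physHermite_odd_zero (m : ℕ) : physHermite (2 * m + 1) 0 = 0 := by
  induction m with
  | zero => simp [physHermite]
  | succ m ih =>
    rw [show 2 * (m + 1) + 1 = 2 * m + 1 + 2 by ring, physHermite, ih]
    ring

lemma hermiteNorm_sq (n : ℕ) : hermiteNorm n ^ 2 = n.factorial * 2 ^ n * Real.sqrt Real.pi :=
  Real.sq_sqrt (by positivity)

lemma hermiteNorm_pos (n : ℕ) : 0 < hermiteNorm n :=
  Real.sqrt_pos.mpr (by positivity)

lemma hermiteFun_zero_eq (n : ℕ) : hermiteFun n 0 = physHermite n 0 / hermiteNorm n := by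
  simp [hermiteFun, hermiteNorm]

lemma hermiteFun_add_two_zero_sq (n : ℕ) :
    hermiteFun (n + 2) 0 ^ 2 = (n + 1) / (n + 2) * hermiteFun n 0 ^ 2 := by
  have hπ : 0 < Real.sqrt Real.pi := by positivity
  have hn : (0 : ℝ) < n.factorial := by positivity
  rw [hermiteFun_zero_eq, hermiteFun_zero_eq, div_pow, div_pow, hermiteNorm_sq, hermiteNorm_sq,
    physHermite, Nat.factorial_succ, Nat.factorial_succ]
  push_cast
  field_simp
  ring

lemma hermiteFunDeriv_zero_sq (n : ℕ) :
    hermiteFunDeriv n 0 ^ 2 = 2 * (n + 1) * hermiteFun n 0 ^ 2 := by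
  have hπ : 0 < Real.sqrt Real.pi := by positivity
  have hn : (0 : ℝ) < n.factorial := by positivity
  rw [hermiteFun_zero_eq, hermiteFunDeriv, div_pow, div_pow, hermiteNorm_sq, hermiteNorm_sq,
    Nat.factorial_succ]
  push_cast
  simp
  field_simp
  ring

lemma hermiteFun_even_zero_bounds (m : ℕ) :
    1 / (16 * m + 4) ≤ (hermiteFun (2 * m) 0 ^ 2) ^ 2 ∧
      (hermiteFun (2 * m) 0 ^ 2) ^ 2 ≤ 1 / (2 * m + 1) := by
  induction m with
  | zero =>
    have h : (hermiteFun (2 * 0) 0 ^ 2) ^ 2 = 1 / Real.pi := by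
      rw [mul_zero, hermiteFun_zero_eq, div_pow, hermiteNorm_sq, div_pow]
      simp [physHermite, Real.sq_sqrt Real.pi_pos.le]
    rw [h]
    have h3 := Real.pi_gt_three
    have h4 := Real.pi_le_four
    constructor
    · simpa using inv_anti₀ (by linarith) h4
    · simpa using inv_le_one_of_one_le₀ (by linarith)
  | succ m ih =>
    rw [show 2 * (m + 1) = 2 * m + 2 by ring, hermiteFun_add_two_zero_sq, mul_pow]
    push_cast
    have hm : (0 : ℝ) ≤ m := m.cast_nonneg
    obtain ⟨ih1, ih2⟩ := ih
    constructor
    · calc (1 : ℝ) / (16 * (m + 1) + 4)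
          ≤ ((2 * m + 1) / (2 * m + 2)) ^ 2 * (1 / (16 * m + 4)) := by
            rw [div_pow, div_mul_div_comm, div_le_div_iff₀ (by positivity) (by positivity)]
            nlinarith
        _ ≤ _ := by gcongr
    · calc _ ≤ ((2 * (m : ℝ) + 1) / (2 * m + 2)) ^ 2 * (1 / (2 * m + 1)) := by gcongr
        _ ≤ _ := by
            rw [div_pow, div_mul_div_comm, div_le_div_iff₀ (by positivity) (by positivity)]
            nlinarith

/-- The energy of the Hermite function of index `n + 1` at the origin is of order `√(n + 1)`. -/
lemma hermite_energy_zero_bounds (n : ℕ) :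
    Real.sqrt ((n + 1 : ℕ) : ℝ) / 2 ≤ hermiteFunDeriv n 0 ^ 2
        + (2 * ((n + 1 : ℕ) : ℝ) + 1) * hermiteFun (n + 1) 0 ^ 2 ∧
      hermiteFunDeriv n 0 ^ 2 + (2 * ((n + 1 : ℕ) : ℝ) + 1) * hermiteFun (n + 1) 0 ^ 2
        ≤ 3 * Real.sqrt ((n + 1 : ℕ) : ℝ) := by
  set T := hermiteFunDeriv n 0 ^ 2 + (2 * ((n + 1 : ℕ) : ℝ) + 1) * hermiteFun (n + 1) 0 ^ 2
    with hT
  have hT0 : 0 ≤ T := by positivity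
  suffices h : ((n + 1 : ℕ) : ℝ) / 4 ≤ T ^ 2 ∧ T ^ 2 ≤ 9 * ((n + 1 : ℕ) : ℝ) by
    have hsq : Real.sqrt ((n + 1 : ℕ) : ℝ) ^ 2 = ((n + 1 : ℕ) : ℝ) :=
      Real.sq_sqrt (Nat.cast_nonneg _)
    constructor
    · exact le_of_sq_le_sq (by rw [div_pow, hsq]; linarith [h.1]) hT0
    · exact le_of_sq_le_sq (by rw [mul_pow, hsq]; linarith [h.2]) (by positivity)
  rw [hT, hermiteFunDeriv_zero_sq]
  obtain ⟨m, rfl | rfl⟩ := n.even_or_odd'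
  · obtain ⟨h1, h2⟩ := hermiteFun_even_zero_bounds m
    have hz : hermiteFun (2 * m + 1) 0 = 0 := by
      rw [hermiteFun_zero_eq, physHermite_odd_zero, zero_div]
    have hm : (0 : ℝ) ≤ m := m.cast_nonneg
    rw [hz]
    push_cast
    rw [show (2 * (2 * (m : ℝ) + 1) * hermiteFun (2 * m) 0 ^ 2
      + (2 * (2 * (m : ℝ) + 1) + 1) * 0 ^ 2) ^ 2
      = 4 * (2 * (m : ℝ) + 1) ^ 2 * (hermiteFun (2 * m) 0 ^ 2) ^ 2 by ring]
    constructor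
    · calc (2 * (m : ℝ) + 1) / 4 ≤ 4 * (2 * (m : ℝ) + 1) ^ 2 * (1 / (16 * m + 4)) := by
            rw [mul_one_div, div_le_div_iff₀ (by positivity) (by positivity)]
            nlinarith
        _ ≤ _ := by gcongr
    · calc _ ≤ 4 * (2 * (m : ℝ) + 1) ^ 2 * (1 / (2 * m + 1)) := by gcongr
        _ ≤ _ := by
            rw [mul_one_div, div_le_iff₀ (by positivity)]
            nlinarith
  · obtain ⟨h1, h2⟩ := hermiteFun_even_zero_bounds (m + 1)
    have hz : hermiteFun (2 * m + 1) 0 = 0 := by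
      rw [hermiteFun_zero_eq, physHermite_odd_zero, zero_div]
    have hm : (0 : ℝ) ≤ m := m.cast_nonneg
    rw [show 2 * (m + 1) = 2 * m + 1 + 1 by ring] at h1 h2
    rw [hz]
    push_cast at h1 h2 ⊢
    rw [show (2 * (2 * (m : ℝ) + 1 + 1) * 0 ^ 2
      + (2 * (2 * (m : ℝ) + 1 + 1) + 1) * hermiteFun (2 * m + 1 + 1) 0 ^ 2) ^ 2
      = (2 * (2 * (m : ℝ) + 1 + 1) + 1) ^ 2 * (hermiteFun (2 * m + 1 + 1) 0 ^ 2) ^ 2 by ring]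
    constructor
    · calc (2 * (m : ℝ) + 1 + 1) / 4
          ≤ (2 * (2 * (m : ℝ) + 1 + 1) + 1) ^ 2 * (1 / (16 * (m + 1) + 4)) := by
            rw [mul_one_div, div_le_div_iff₀ (by positivity) (by positivity)]
            nlinarith
        _ ≤ _ := by gcongr
    · calc _ ≤ (2 * (2 * (m : ℝ) + 1 + 1) + 1) ^ 2 * (1 / (2 * (m + 1) + 1)) := by gcongr
        _ ≤ _ := by
            rw [mul_one_div, div_le_iff₀ (by positivity)]
            nlinarith

theorem statement13 :
    ∃ C C' c : ℝ, 0 < C ∧ 0 < C' ∧ 0 < c ∧ ∀ k : ℕ, 1 ≤ k →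
      ∀ s ∈ Set.Icc (0 : ℝ) (c / Real.sqrt k),
        C * s ^ 2 ≤ OmegaFun k s / Real.sqrt k ∧ OmegaFun k s / Real.sqrt k ≤ C' * s ^ 2 := by
  refine ⟨1 / 200, 9, 1 / 100, by norm_num, by norm_num, by norm_num, fun k hk s hs => ?_⟩
  obtain ⟨n, rfl⟩ : ∃ n, k = n + 1 := ⟨k - 1, by omega⟩
  obtain ⟨hT1, hT2⟩ := hermite_energy_zero_bounds n
  have hk1 : (1 : ℝ) ≤ ((n + 1 : ℕ) : ℝ) := by exact_mod_cast hk
  have hr : 1 ≤ Real.sqrt ((n + 1 : ℕ) : ℝ) := Real.one_le_sqrt.mpr hk1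
  have hr2 : Real.sqrt ((n + 1 : ℕ) : ℝ) ^ 2 = ((n + 1 : ℕ) : ℝ) := Real.sq_sqrt (by linarith)
  set r := Real.sqrt ((n + 1 : ℕ) : ℝ) with hrdef
  have hE := fun (u : ℝ) (hu : 0 < u) (hu2 : u ≤ 2) =>
    hermite_energy_bounds (by linarith) (hasDerivAt_hermiteFun n) (hasDerivAt_hermiteFunDeriv n)
      (Real.sqrt_nonneg u) ((Real.sq_sqrt hu.le).trans_le hu2)
  set T := hermiteFunDeriv n 0 ^ 2 + (2 * ((n + 1 : ℕ) : ℝ) + 1) * hermiteFun (n + 1) 0 ^ 2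
    with hT
  have hS2 : Real.sqrt T ^ 2 = T := Real.sq_sqrt (by linarith)
  set g : ℝ → ℝ := fun u => hermiteFun (n + 1) (Real.sqrt u) with hgdef
  set p : ℝ → ℝ := fun u => hermiteFunDeriv n (Real.sqrt u) / (2 * Real.sqrt u) with hpdef
  have hg : ∀ u, 0 < u → HasDerivAt g (p u) u := fun u hu => by
    refine HasDerivAt.congr_deriv ((hasDerivAt_hermiteFun n (Real.sqrt u)).comp u (Real.hasDerivAt_sqrt hu.ne')) ?_
    simp only [hpdef]
    ring
  have hp : ∀ u, 0 < u →
      HasDerivAt p (-((2 * p u + (2 * r ^ 2 + 1 - u) * g u) / (4 * u))) u := fun u hu => by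
    have hsu := Real.sqrt_pos.mpr hu
    have hsq := Real.sq_sqrt hu.le
    refine HasDerivAt.congr_deriv (((hasDerivAt_hermiteFunDeriv n (Real.sqrt u)).comp u
      (Real.hasDerivAt_sqrt hu.ne')).div ((Real.hasDerivAt_sqrt hu.ne').const_mul 2)
      (by positivity)) ?_
    simp only [hpdef, hgdef, hr2, Function.comp_apply]
    generalize hv : Real.sqrt u = v at *
    subst hsq
    field_simp
    ring
  have hEeq : ∀ u, 0 < u → 4 * u * p u ^ 2 + (2 * r ^ 2 + 1 - u) * g u ^ 2
      = hermiteFunDeriv n (Real.sqrt u) ^ 2 + (2 * ((n + 1 : ℕ) : ℝ) + 1 - Real.sqrt u ^ 2)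
        * hermiteFun (n + 1) (Real.sqrt u) ^ 2 := fun u hu => by
    simp only [hpdef, hgdef, hr2, div_pow, mul_pow, Real.sq_sqrt hu.le]
    field_simp
    ring
  obtain ⟨h1, h2⟩ := sq_sub_mul_bounds hr (Real.sqrt_nonneg T) hg hp
    (fun u hu hu2 => by rw [hS2, hEeq u hu]; exact (hE u hu hu2).1)
    (fun u hu hu2 => by rw [hS2, hEeq u hu]; exact (hE u hu hu2).2) s hs
  have hO : OmegaFun (n + 1) s = g 1 ^ 2 - g (1 - s) * g (1 + s) := by
    simp [OmegaFun, hgdef]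
  rw [hS2] at h1 h2
  rw [hO, le_div_iff₀ (by linarith), div_le_iff₀ (by linarith)]
  constructor
  · have := mul_le_mul_of_nonneg_right hT1 (sq_nonneg s)
    linarith
  · have := mul_le_mul_of_nonneg_right hT2 (sq_nonneg s)
    linarith

end
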